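/- (i) There is a constant C, depending only on Γ and η₀, such that for every finite set E of integers greater than 10, every j₂ ∈ ℤ and all ξ₁, x₂, y₂ ∈ ℝ, one has |χ̃_{2,j₂}(x₂−y₂) · Σ_{j₁∈E} h_{j₁}(ξ₁,x₂,y₂)| ≤ C, and this expression vanishes unless 2^{j₂−2} ≤ |x₂−y₂| ≤ 2^{j₂+2}. (ii) |h_{j₁}(ξ₁,x₂,y₂)| ≤ C · 2^{j₁} · |x₂²−y₂²| for every integer j₁ > 10 and all ξ₁, x₂, y₂. (iii) For every positive integer N there is a constant C_N, depending only on N, Γ and η₀, such that if |ξ₁ − γ(x₂²+y₂²)| ≥ 2|x₂²−y₂²| then |h_{j₁}(ξ₁,x₂,y₂)| ≤ C_N · (2^{j₁}|ξ₁ − γ(x₂²+y₂²)|)^{−N}. -/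

import Mathlib

/- STATEMENT 8: estimates for the kernels h_{j₁} (Lemma 4.2). -/

open MeasureTheory Polynomial

noncomputable section

/-- `β(t) = (1 + t²/4)^(1/2)`. -/
def bet (t : ℝ) : ℝ := Real.sqrt (1 + t ^ 2 / 4)

/-- The phase `Ψ(x,y) = (x₁−y₁)(x₂²+y₂²) − (x₂−y₂)·p(x₁+y₁)`. -/
def Psi (p : Polynomial ℝ) (x y : ℝ × ℝ) : ℝ :=
  (x.1 - y.1) * (x.2 ^ 2 + y.2 ^ 2) - (x.2 - y.2) * p.eval (x.1 + y.1)

/-- `θ(x,y) = β(x₁−y₁)·|x₂+y₂+p′(x₁+y₁)|·(x₂−y₂)`. -/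
def theta (p : Polynomial ℝ) (x y : ℝ × ℝ) : ℝ :=
  bet (x.1 - y.1) * |x.2 + y.2 + p.derivative.eval (x.1 + y.1)| * (x.2 - y.2)

/-- `sin θ(x,y)/(x₂−y₂)`, extended continuously across `x₂ = y₂`. -/
def sinq (p : Polynomial ℝ) (x y : ℝ × ℝ) : ℝ :=
  if x.2 = y.2 then bet (x.1 - y.1) * |x.2 + y.2 + p.derivative.eval (x.1 + y.1)|
  else Real.sin (theta p x y) / (x.2 - y.2)

/-- `g` has only finitely many sign changes: there is a uniform bound `N` on the length of
increasing chains of points at which `g` changes sign between consecutive points. -/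
def FinSignChanges (g : ℝ → ℝ) : Prop :=
  ∃ N : ℕ, ∀ s : ℕ → ℝ, StrictMono s →
    ∀ m : ℕ, (∀ i < m, g (s i) * g (s (i + 1)) < 0) → m ≤ N

/-- The standing hypotheses on the cut-off function `η₀`: smooth, even, `[0,1]`-valued,
`≡ 1` on `{|s| ≤ 1/2}`, `≡ 0` on `{|s| ≥ 3/4}`, and `η₀′` has finitely many sign changes. -/
structure CutoffFun (η₀ : ℝ → ℝ) : Prop where
  smooth : ContDiff ℝ (⊤ : ℕ∞) η₀
  even : ∀ s, η₀ (-s) = η₀ s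
  mem01 : ∀ s, η₀ s ∈ Set.Icc (0 : ℝ) 1
  eq_one : ∀ s, |s| ≤ 1 / 2 → η₀ s = 1
  eq_zero : ∀ s, 3 / 4 ≤ |s| → η₀ s = 0
  signChanges : FinSignChanges (deriv η₀)

/-- `η(s) = η₀(s/2) − η₀(s)`. -/
def etad (η₀ : ℝ → ℝ) (s : ℝ) : ℝ := η₀ (s / 2) - η₀ s

/-- `χ_{1,j₁}(s) = 2^{j₁}·η(2^{−j₁}s)/β(s)`. -/
def chi1 (η₀ : ℝ → ℝ) (j₁ : ℤ) (s : ℝ) : ℝ :=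
  (2 : ℝ) ^ j₁ * etad η₀ ((2 : ℝ) ^ (-j₁) * s) / bet s

/-- `χ_{2,j₂}(s) = 2^{j₂}·η(2^{−j₂}s)/s`. -/
def chi2 (η₀ : ℝ → ℝ) (j₂ : ℤ) (s : ℝ) : ℝ :=
  (2 : ℝ) ^ j₂ * etad η₀ ((2 : ℝ) ^ (-j₂) * s) / s

/-- The kernel `T_j(x,y) = 2^{−j₁−j₂}·χ_j(x−y)·e^{iγΨ(x,y)}·sin θ(x,y)`. -/
def Tker (η₀ : ℝ → ℝ) (p : Polynomial ℝ) (γ : ℝ) (j : ℤ × ℤ) (x y : ℝ × ℝ) : ℂ :=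
  ((2 : ℝ) ^ (-j.1 - j.2) * chi1 η₀ j.1 (x.1 - y.1) * chi2 η₀ j.2 (x.2 - y.2) *
      Real.sin (theta p x y) : ℝ) * Complex.exp (Complex.I * (γ * Psi p x y : ℝ))

/-- `χ̃_{2,j₂}(s) = 2^{j₂}·η(2^{−j₂}s)/|s|`. -/
def chi2t (η₀ : ℝ → ℝ) (j₂ : ℤ) (s : ℝ) : ℝ :=
  (2 : ℝ) ^ j₂ * etad η₀ ((2 : ℝ) ^ (-j₂) * s) / |s|

/-- `h_{j₁}(ξ₁,x₂,y₂) = 2^{−j₁} ∫ exp(iσγ(x₂²+y₂²) − iσξ₁)·sin(β(σ)|x₂²−y₂²|)·χ_{1,j₁}(σ) dσ`. -/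
def hfun (η₀ : ℝ → ℝ) (γ : ℝ) (j₁ : ℤ) (ξ₁ x₂ y₂ : ℝ) : ℂ :=
  ((2 : ℝ) ^ (-j₁) : ℝ) *
    ∫ σ : ℝ, Complex.exp (Complex.I * (σ * γ * (x₂ ^ 2 + y₂ ^ 2) - σ * ξ₁ : ℝ)) *
      ((Real.sin (bet σ * |x₂ ^ 2 - y₂ ^ 2|) * chi1 η₀ j₁ σ : ℝ) : ℂ)

theorem abs_integral_sin_mul_le_of_dominant {α δ M w R : ℝ} {m : ℝ → ℝ} (hm : ContDiff ℝ 1 m)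
    (hM : ∀ u, |m u| ≤ M) (hM' : ∀ u, |deriv m u| ≤ M) (hwR : w ≤ R)
    (hw : 1 ≤ |α| * Real.exp w)
    (hδ : ∀ u, w ≤ u → |δ| * Real.exp (-u) ≤ |α| * Real.exp u / 2) :
    |∫ u in w..R, Real.sin (α * Real.exp u + δ * Real.exp (-u)) * m u| ≤ 12 * M := by
  have hM0 : 0 ≤ M := (abs_nonneg _).trans (hM 0)
  have hα : 0 < |α| := by
    by_contra h
    have : |α| = 0 := le_antisymm (not_lt.1 h) (abs_nonneg _)
    rw [this] at hw; norm_num at hw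
  set p : ℝ → ℝ := fun u => α * Real.exp u + δ * Real.exp (-u) with hp
  set p' : ℝ → ℝ := fun u => α * Real.exp u - δ * Real.exp (-u) with hp'
  have hdp : ∀ u, HasDerivAt p (p' u) u := fun u => by
    have h1 := (Real.hasDerivAt_exp u).const_mul α
    have h2 := ((Real.hasDerivAt_exp (-u)).comp u (hasDerivAt_neg u)).const_mul δ
    refine (h1.add h2).congr_deriv ?_
    simp [hp']; ring
  have hdp' : ∀ u, HasDerivAt p' (p u) u := fun u => by
    have h1 := (Real.hasDerivAt_exp u).const_mul α
    have h2 := ((Real.hasDerivAt_exp (-u)).comp u (hasDerivAt_neg u)).const_mul δ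
    refine (h1.sub h2).congr_deriv ?_
    simp [hp]
  have hlow : ∀ u, w ≤ u → |α| * Real.exp u / 2 ≤ |p' u| := fun u hu => by
    have h1 := abs_sub_abs_le_abs_sub (α * Real.exp u) (δ * Real.exp (-u))
    rw [abs_mul, abs_mul, Real.abs_exp, Real.abs_exp] at h1
    have := hδ u hu
    simp only [hp']; linarith
  have hup : ∀ u, w ≤ u → |p u| ≤ 3 / 2 * (|α| * Real.exp u) := fun u hu => by
    have h1 := abs_add_le (α * Real.exp u) (δ * Real.exp (-u))
    rw [abs_mul, abs_mul, Real.abs_exp, Real.abs_exp] at h1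
    have := hδ u hu
    simp only [hp]; linarith
  have hf1 : ∀ u, w ≤ u → 1 ≤ |α| * Real.exp u := fun u hu =>
    hw.trans (mul_le_mul_of_nonneg_left (Real.exp_le_exp.2 hu) hα.le)
  have hne : ∀ u, w ≤ u → p' u ≠ 0 := fun u hu => by
    have := hlow u hu
    have := hf1 u hu
    exact abs_pos.1 (by linarith)
  have hdm : ∀ u, HasDerivAt m (deriv m u) u := fun u =>
    (hm.differentiable one_ne_zero u).hasDerivAt
  have hcm' : Continuous (deriv m) := hm.continuous_deriv le_rfl
  have hcp : Continuous p := continuous_iff_continuousAt.2 fun u => (hdp u).continuousAt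
  have hcp' : Continuous p' := continuous_iff_continuousAt.2 fun u => (hdp' u).continuousAt
  have hcm : Continuous m := hm.continuous
  set F : ℝ → ℝ := fun u => -(Real.cos (p u) * (m u / p' u)) with hF
  set E : ℝ → ℝ := fun u => Real.cos (p u) * ((deriv m u * p' u - m u * p u) / p' u ^ 2) with hE
  have huIcc : Set.uIcc w R = Set.Icc w R := Set.uIcc_of_le hwR
  have hcE : ContinuousOn E (Set.uIcc w R) := by
    rw [huIcc]
    refine (Real.continuous_cos.comp hcp).continuousOn.mul (ContinuousOn.div ?_ ?_ ?_)
    · exact ((hcm'.mul hcp').sub (hcm.mul hcp)).continuousOn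
    · exact (hcp'.pow 2).continuousOn
    · intro u hu; exact pow_ne_zero 2 (hne u hu.1)
  have hS : Continuous fun u => Real.sin (p u) * m u := (Real.continuous_sin.comp hcp).mul hcm
  have hFD : ∀ u ∈ Set.uIcc w R, HasDerivAt F (Real.sin (p u) * m u - E u) u := by
    rw [huIcc]
    intro u hu
    have h0 := hne u hu.1
    refine (((hdp u).cos.mul ((hdm u).div (hdp' u) h0)).neg).congr_deriv ?_
    simp only [hE, Pi.div_apply]
    field_simp
    ring
  have hFTC := intervalIntegral.integral_eq_sub_of_hasDerivAt hFD
    ((hS.intervalIntegrable _ _).sub hcE.intervalIntegrable)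
  rw [intervalIntegral.integral_sub (hS.intervalIntegrable _ _) hcE.intervalIntegrable] at hFTC
  have hFb : ∀ u, w ≤ u → |F u| ≤ 2 * M := fun u hu => by
    have h1 := hlow u hu
    have h2 := hf1 u hu
    simp only [hF]
    rw [abs_neg, abs_mul, abs_div]
    have h3 : |m u| / |p' u| ≤ 2 * M := by
      rw [div_le_iff₀ (by linarith)]
      nlinarith [hM u]
    calc _ ≤ 1 * (|m u| / |p' u|) :=
          mul_le_mul_of_nonneg_right (Real.abs_cos_le_one _) (by positivity)
      _ ≤ _ := by linarith
  have hEb : ∀ u, w ≤ u → |E u| ≤ 8 * M / |α| * Real.exp (-u) := fun u hu => by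
    have h1 := hlow u hu
    have h2 := hf1 u hu
    have h4 := hup u hu
    set f := |α| * Real.exp u with hf
    have h5 : 8 * M / |α| * Real.exp (-u) = 8 * M / f := by
      rw [hf, Real.exp_neg]; field_simp
    rw [h5]
    simp only [hE]
    rw [abs_mul, abs_div, abs_pow]
    have h6 : |deriv m u * p' u - m u * p u| / |p' u| ^ 2 ≤ 8 * M / f := by
      have h7 : |deriv m u * p' u - m u * p u| ≤ M * |p' u| + M * (3 / 2 * f) := by
        refine (abs_sub _ _).trans ?_
        rw [abs_mul, abs_mul]
        gcongr
        · exact hM' u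
        · exact hM u
      have hpos : 0 < |p' u| := by linarith
      rw [div_le_div_iff₀ (by positivity) (by linarith)]
      have h8 : f * (|p' u| + 3 / 2 * f) ≤ 8 * |p' u| ^ 2 := by nlinarith
      nlinarith
    calc _ ≤ 1 * (|deriv m u * p' u - m u * p u| / |p' u| ^ 2) :=
          mul_le_mul_of_nonneg_right (Real.abs_cos_le_one _) (by positivity)
      _ ≤ _ := by linarith
  have hEint : |∫ u in w..R, E u| ≤ 8 * M := by
    have h1 := intervalIntegral.norm_integral_le_of_norm_le (μ := volume) (f := E)
      (g := fun u => 8 * M / |α| * Real.exp (-u)) hwR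
      (Filter.Eventually.of_forall fun u hu => hEb u hu.1.le)
      (Continuous.intervalIntegrable (by fun_prop) _ _)
    rw [intervalIntegral.integral_const_mul, intervalIntegral.integral_comp_neg Real.exp,
      integral_exp] at h1
    refine h1.trans ?_
    have h2 : 8 * M / |α| * Real.exp (-w) ≤ 8 * M := by
      rw [Real.exp_neg, div_mul_eq_mul_div, div_le_iff₀ hα, mul_inv_le_iff₀ (Real.exp_pos _)]
      nlinarith
    have h3 : 0 ≤ 8 * M / |α| * Real.exp (-R) := by positivity
    rw [mul_sub]; linarith
  have h1 := hFb w le_rfl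
  have h2 := hFb R hwR
  rw [abs_le] at *
  constructor <;> linarith [hFTC]

theorem abs_integral_sin_mul_le_of_small {α δ M w R : ℝ} {m : ℝ → ℝ} (hM : ∀ u, |m u| ≤ M)
    (hwR : w ≤ R) (hR : |α| * Real.exp R ≤ 1)
    (hδ : ∀ u, w ≤ u → |δ| * Real.exp (-u) ≤ |α| * Real.exp u / 2) :
    |∫ u in w..R, Real.sin (α * Real.exp u + δ * Real.exp (-u)) * m u| ≤ 2 * M := by
  have hM0 : 0 ≤ M := (abs_nonneg _).trans (hM 0)
  have h1 := intervalIntegral.norm_integral_le_of_norm_le (μ := volume)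
      (f := fun u => Real.sin (α * Real.exp u + δ * Real.exp (-u)) * m u)
      (g := fun u => (2 * M * |α|) * Real.exp u) hwR
      (Filter.Eventually.of_forall fun u hu => ?_)
      (Continuous.intervalIntegrable (by fun_prop) _ _)
  · rw [intervalIntegral.integral_const_mul, integral_exp] at h1
    refine h1.trans ?_
    have h3 : 0 ≤ 2 * M * |α| * Real.exp w := by positivity
    nlinarith
  · have h2 : |Real.sin (α * Real.exp u + δ * Real.exp (-u))| ≤ 2 * (|α| * Real.exp u) := by
      refine Real.abs_sin_le_abs.trans ((abs_add_le _ _).trans ?_)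
      rw [abs_mul, abs_mul, Real.abs_exp, Real.abs_exp]
      have := hδ u hu.1.le
      have : 0 ≤ |α| * Real.exp u := by positivity
      linarith
    rw [Real.norm_eq_abs, abs_mul]
    calc _ ≤ 2 * (|α| * Real.exp u) * M := by
          gcongr
          exact hM u
      _ = _ := by ring

theorem abs_integral_sin_mul_le_right {α δ M U R : ℝ} {m : ℝ → ℝ} (hm : ContDiff ℝ 1 m)
    (hM : ∀ u, |m u| ≤ M) (hM' : ∀ u, |deriv m u| ≤ M) (hUR : U ≤ R)
    (hδ : |δ| * Real.exp (-U) ≤ |α| * Real.exp U) :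
    |∫ u in U..R, Real.sin (α * Real.exp u + δ * Real.exp (-u)) * m u| ≤ 15 * M := by
  have hM0 : 0 ≤ M := (abs_nonneg _).trans (hM 0)
  have hcm : Continuous m := hm.continuous
  have hint : ∀ x y, IntervalIntegrable
      (fun u => Real.sin (α * Real.exp u + δ * Real.exp (-u)) * m u) volume x y := fun x y =>
    Continuous.intervalIntegrable (by fun_prop) _ _
  have hshort : ∀ V, U ≤ V → V ≤ U + 1 →
      |∫ u in U..V, Real.sin (α * Real.exp u + δ * Real.exp (-u)) * m u| ≤ M := by
    intro V h1 h2
    have h3 := intervalIntegral.norm_integral_le_of_norm_le_const (a := U) (b := V) (C := M)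
      (f := fun u => Real.sin (α * Real.exp u + δ * Real.exp (-u)) * m u) (fun u _ => ?_)
    · refine h3.trans ?_
      rw [abs_of_nonneg (by linarith)]
      nlinarith
    · rw [Real.norm_eq_abs, abs_mul]
      calc _ ≤ 1 * |m u| :=
            mul_le_mul_of_nonneg_right (Real.abs_sin_le_one _) (abs_nonneg _)
        _ ≤ M := by linarith [hM u]
  rcases le_total R (U + 1) with hR | hR
  · linarith [hshort R hUR hR]
  have hdom : ∀ u, U + 1 ≤ u → |δ| * Real.exp (-u) ≤ |α| * Real.exp u / 2 := by
    intro u hu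
    have e1 : Real.exp (-u) = Real.exp (-U) * Real.exp (U - u) := by
      rw [← Real.exp_add]; ring_nf
    have e2 : Real.exp U = Real.exp u * Real.exp (U - u) := by
      rw [← Real.exp_add]; ring_nf
    have h3 : Real.exp (U - u) ≤ 1 / 2 := by
      have : Real.exp (U - u) ≤ Real.exp (-1) := Real.exp_le_exp.2 (by linarith)
      have := Real.exp_neg_one_lt_d9
      linarith
    have h4 := Real.exp_pos (U - u)
    have h5 : 0 ≤ |α| * Real.exp u := by positivity
    calc |δ| * Real.exp (-u) = (|δ| * Real.exp (-U)) * Real.exp (U - u) := by rw [e1]; ring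
      _ ≤ (|α| * Real.exp U) * Real.exp (U - u) := by gcongr
      _ = (|α| * Real.exp u) * (Real.exp (U - u) * Real.exp (U - u)) := by rw [e2]; ring
      _ ≤ (|α| * Real.exp u) * (1 / 2) := by
          apply mul_le_mul_of_nonneg_left _ h5
          nlinarith
      _ = _ := by ring
  have h1 := hshort (U + 1) (by linarith) le_rfl
  have hrest : |∫ u in (U + 1)..R, Real.sin (α * Real.exp u + δ * Real.exp (-u)) * m u|
      ≤ 14 * M := by
    rcases le_total (|α| * Real.exp R) 1 with h2 | h2
    · linarith [abs_integral_sin_mul_le_of_small hM hR h2 hdom]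
    rcases le_total 1 (|α| * Real.exp (U + 1)) with h3 | h3
    · linarith [abs_integral_sin_mul_le_of_dominant hm hM hM' hR h3 hdom]
    obtain ⟨L, hL, hL1⟩ : ∃ L ∈ Set.Icc (U + 1) R, |α| * Real.exp L = 1 :=
      intermediate_value_Icc hR (f := fun u => |α| * Real.exp u) (by fun_prop) ⟨h3, h2⟩
    have h4 := abs_integral_sin_mul_le_of_small hM hL.1 hL1.le hdom
    have h5 := abs_integral_sin_mul_le_of_dominant hm hM hM' hL.2 hL1.ge
      (fun u hu => hdom u (hL.1.trans hu))
    rw [← intervalIntegral.integral_add_adjacent_intervals (hint (U + 1) L) (hint L R)]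
    exact (abs_add_le _ _).trans (by linarith)
  rw [← intervalIntegral.integral_add_adjacent_intervals (hint U (U + 1)) (hint (U + 1) R)]
  exact (abs_add_le _ _).trans (by linarith)

theorem abs_integral_sin_mul_le {α δ M R : ℝ} {m : ℝ → ℝ} (hm : ContDiff ℝ 1 m)
    (hM : ∀ u, |m u| ≤ M) (hM' : ∀ u, |deriv m u| ≤ M) (hR : 0 ≤ R) :
    |∫ u in -R..R, Real.sin (α * Real.exp u + δ * Real.exp (-u)) * m u| ≤ 30 * M := by
  have hM0 : 0 ≤ M := (abs_nonneg _).trans (hM 0)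
  have hcm : Continuous m := hm.continuous
  have hint : ∀ x y, IntervalIntegrable
      (fun u => Real.sin (α * Real.exp u + δ * Real.exp (-u)) * m u) volume x y := fun x y =>
    Continuous.intervalIntegrable (by fun_prop) _ _
  have hleft : ∀ U, -R ≤ U → |α| * Real.exp U ≤ |δ| * Real.exp (-U) →
      |∫ u in -R..U, Real.sin (α * Real.exp u + δ * Real.exp (-u)) * m u| ≤ 15 * M := by
    intro U hU h
    have h1 := abs_integral_sin_mul_le_right (α := δ) (δ := α) (U := -U) (R := R)
      (m := fun u => m (-u)) (M := M) (hm.comp contDiff_neg) (fun u => hM (-u))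
      (fun u => by rw [deriv_comp_neg, abs_neg]; exact hM' (-u)) (by linarith)
      (by rwa [neg_neg])
    have h2 := intervalIntegral.integral_comp_neg (a := -U) (b := R)
      (fun u => Real.sin (α * Real.exp u + δ * Real.exp (-u)) * m u)
    rw [neg_neg] at h2
    rw [← h2]
    convert h1 using 5 with u
    rw [neg_neg, add_comm]
  rcases le_total (|δ| * Real.exp (- -R)) (|α| * Real.exp (-R)) with h1 | h1
  · linarith [abs_integral_sin_mul_le_right hm hM hM' (by linarith : -R ≤ R) h1]
  rcases le_total (|α| * Real.exp R) (|δ| * Real.exp (-R)) with h2 | h2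
  · linarith [hleft R (by linarith) h2]
  obtain ⟨L, hL, hL1⟩ : ∃ L ∈ Set.Icc (-R) R, |α| * Real.exp L - |δ| * Real.exp (-L) = 0 :=
    intermediate_value_Icc (by linarith)
      (f := fun u => |α| * Real.exp u - |δ| * Real.exp (-u)) (by fun_prop)
      ⟨by simpa using h1, by simpa using h2⟩
  have h4 := hleft L hL.1 (by linarith)
  have h5 := abs_integral_sin_mul_le_right hm hM hM' (δ := δ) (α := α) hL.2 (by linarith)
  rw [← intervalIntegral.integral_add_adjacent_intervals (hint (-R) L) (hint L R)]
  exact (abs_add_le _ _).trans (by linarith)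

theorem exists_bound_nonstationary {E : Type*} [NormedAddCommGroup E] [NormedSpace ℝ E]
    {K : Set E} (hK : IsCompact K) {q q' G : E × ℝ → ℝ} (hqc : Continuous q)
    (hq'c : Continuous q')
    (hq : ∀ p ∈ K, ∀ s, HasDerivAt (fun t => q (p, t)) (q' (p, s)) s)
    (hG : ContDiff ℝ (⊤ : ℕ∞) G) (hGq : ∀ p ∈ K, ∀ s, q' (p, s) * G (p, s) = 1) {r : ℝ}
    (hr : 0 ≤ r) (N : ℕ) :
    ∀ f : E × ℝ → ℝ, ContDiff ℝ (⊤ : ℕ∞) f →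
      (∀ p ∈ K, ∀ s ∉ Set.Icc (-r) r, f (p, s) = 0) →
      ∃ C, ∀ p ∈ K, ∀ A θ : ℝ,
        |A| ^ N * |∫ s in -(r + 1)..(r + 1), Real.sin (A * q (p, s) + θ) * f (p, s)| ≤ C := by
  induction N with
  | zero =>
    intro f hf hsupp
    obtain ⟨C, hC⟩ := (hK.prod (isCompact_Icc (a := -(r + 1)) (b := r + 1))).exists_bound_of_continuousOn
      hf.continuous.continuousOn
    refine ⟨C * |r + 1 - -(r + 1)|, fun p hp A θ => ?_⟩
    rw [pow_zero, one_mul]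
    rw [← Real.norm_eq_abs (∫ s in _.._, _)]
    refine intervalIntegral.norm_integral_le_of_norm_le_const fun s hs => ?_
    rw [Set.uIoc_of_le (by linarith)] at hs
    have h1 := hC (p, s) ⟨hp, hs.1.le, hs.2⟩
    rw [Real.norm_eq_abs, abs_mul]
    calc _ ≤ 1 * |f (p, s)| :=
          mul_le_mul_of_nonneg_right (Real.abs_sin_le_one _) (abs_nonneg _)
      _ ≤ C := by rw [one_mul]; exact h1
  | succ n ih =>
    intro f hf hsupp
    set g : E × ℝ → ℝ := fun z => f z * G z with hg
    have hgs : ContDiff ℝ (⊤ : ℕ∞) g := hf.mul hG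
    set f₁ : E × ℝ → ℝ := fun z => fderiv ℝ g z (0, 1) with hf₁
    have hf₁s : ContDiff ℝ (⊤ : ℕ∞) f₁ :=
      (hgs.fderiv_right (m := (⊤ : ℕ∞)) (by exact_mod_cast le_top)).clm_apply contDiff_const
    have hgd : ∀ p s, HasDerivAt (fun t => g (p, t)) (f₁ (p, s)) s := fun p s =>
      (hgs.differentiable (by simp) (p, s)).hasFDerivAt.comp_hasDerivAt (f := fun t => (p, t)) s
        ((hasDerivAt_const s p).prodMk (hasDerivAt_id s))
    have hsupp₁ : ∀ p ∈ K, ∀ s ∉ Set.Icc (-r) r, f₁ (p, s) = 0 := by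
      intro p hp s hs
      have h0 : (fun t => g (p, t)) =ᶠ[nhds s] fun _ => 0 := by
        filter_upwards [isClosed_Icc.isOpen_compl.mem_nhds hs] with t ht
        simp [hg, hsupp p hp t ht]
      exact (hgd p s).unique ((hasDerivAt_const s (0 : ℝ)).congr_of_eventuallyEq h0)
    obtain ⟨C, hC⟩ := ih f₁ hf₁s hsupp₁
    refine ⟨C, fun p hp A θ => ?_⟩
    have hv : ∀ s, HasDerivAt (fun t => Real.cos (A * q (p, t) + θ))
        (-Real.sin (A * q (p, s) + θ) * (A * q' (p, s))) s := fun s =>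
      (((hq p hp s).const_mul A).add_const θ).cos
    have hip := intervalIntegral.integral_mul_deriv_eq_deriv_mul
      (a := -(r + 1)) (b := r + 1) (fun s _ => hgd p s) (fun s _ => hv s)
      (Continuous.intervalIntegrable (hf₁s.continuous.comp (by fun_prop)) _ _)
      (Continuous.intervalIntegrable (by fun_prop) _ _)
    have hb1 : g (p, r + 1) = 0 := by
      simp [hg, hsupp p hp (r + 1) (fun h => by linarith [h.2])]
    have hb2 : g (p, -(r + 1)) = 0 := by
      simp only [hg, hsupp p hp (-(r + 1)) (fun h => by linarith [h.1]), zero_mul]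
    rw [hb1, hb2, zero_mul, zero_mul, sub_zero, zero_sub] at hip
    have hL : ∀ s, g (p, s) * (-Real.sin (A * q (p, s) + θ) * (A * q' (p, s)))
        = -A * (Real.sin (A * q (p, s) + θ) * f (p, s)) := fun s => by
      have := hGq p hp s
      simp only [hg]
      linear_combination (-A * f (p, s) * Real.sin (A * q (p, s) + θ)) * this
    have hRs : ∀ s, f₁ (p, s) * Real.cos (A * q (p, s) + θ)
        = Real.sin (A * q (p, s) + (θ + Real.pi / 2)) * f₁ (p, s) := fun s => by
      rw [← add_assoc, Real.sin_add_pi_div_two]; ring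
    simp only [hL, hRs] at hip
    rw [intervalIntegral.integral_const_mul] at hip
    have h1 := hC p hp A (θ + Real.pi / 2)
    have h2 : |A| * |∫ s in -(r + 1)..(r + 1), Real.sin (A * q (p, s) + θ) * f (p, s)|
        = |∫ s in -(r + 1)..(r + 1), Real.sin (A * q (p, s) + (θ + Real.pi / 2)) * f₁ (p, s)| := by
      rw [← abs_mul, ← abs_neg]
      rw [show -(A * ∫ s in -(r + 1)..(r + 1), Real.sin (A * q (p, s) + θ) * f (p, s))
        = -A * ∫ s in -(r + 1)..(r + 1), Real.sin (A * q (p, s) + θ) * f (p, s) by ring, hip,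
        abs_neg]
    rw [pow_succ, mul_assoc, h2]
    exact h1

theorem integral_eq_zero_of_odd {F : ℝ → ℂ} (h : ∀ s, F (-s) = -F s) : ∫ s, F s = 0 := by
  have h1 := integral_neg_eq_self F volume
  simp only [h, integral_neg] at h1
  exact self_eq_neg.1 h1.symm

namespace CutoffFun

variable {η₀ : ℝ → ℝ}

theorem contDiff_etad (h : CutoffFun η₀) : ContDiff ℝ (⊤ : ℕ∞) (etad η₀) :=
  (h.smooth.comp (contDiff_id.div_const 2)).sub h.smooth

theorem etad_neg (h : CutoffFun η₀) (s : ℝ) : etad η₀ (-s) = etad η₀ s := by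
  simp only [etad, neg_div, h.even]

theorem abs_etad_le (h : CutoffFun η₀) (s : ℝ) : |etad η₀ s| ≤ 1 := by
  have h1 := h.mem01 s
  have h2 := h.mem01 (s / 2)
  rw [etad, abs_le]
  constructor <;> linarith [h1.1, h1.2, h2.1, h2.2]

theorem etad_eq_zero (h : CutoffFun η₀) {s : ℝ} (hs : ¬(1 / 2 ≤ |s| ∧ |s| ≤ 3 / 2)) :
    etad η₀ s = 0 := by
  have h2 : |s / 2| = |s| / 2 := by rw [abs_div, abs_two]
  rw [not_and_or, not_le, not_le] at hs
  rcases hs with hs | hs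
  · rw [etad, h.eq_one s hs.le, h.eq_one _ (by rw [h2]; linarith [abs_nonneg s]), sub_self]
  · rw [etad, h.eq_zero s (by linarith), h.eq_zero _ (by rw [h2]; linarith), sub_self]

theorem tsupport_etad (h : CutoffFun η₀) :
    tsupport (etad η₀) ⊆ {s | 1 / 2 ≤ |s| ∧ |s| ≤ 3 / 2} := by
  refine closure_minimal (fun s hs => ?_) ?_
  · by_contra hc
    exact hs (h.etad_eq_zero hc)
  · exact (isClosed_le continuous_const continuous_abs).inter
      (isClosed_le continuous_abs continuous_const)

theorem deriv_etad_eq_zero (h : CutoffFun η₀) {s : ℝ} (hs : ¬(1 / 2 ≤ |s| ∧ |s| ≤ 3 / 2)) :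
    deriv (etad η₀) s = 0 := by
  by_contra hc
  exact hs (h.tsupport_etad (support_deriv_subset hc))

theorem exists_abs_deriv_etad_le (h : CutoffFun η₀) : ∃ C, ∀ s, |deriv (etad η₀) s| ≤ C := by
  obtain ⟨C, hC⟩ := (isCompact_Icc (a := -(3 / 2 : ℝ)) (b := 3 / 2)).exists_bound_of_continuousOn
    (h.contDiff_etad.continuous_deriv (by simp)).continuousOn
  refine ⟨C, fun s => ?_⟩
  by_cases hs : |s| ≤ 3 / 2
  · exact hC s (abs_le.1 hs)
  · rw [h.deriv_etad_eq_zero fun h' => hs h'.2, abs_zero]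
    exact (norm_nonneg _).trans (hC 0 (by norm_num))

end CutoffFun

/-- At most three dyadic dilates of a function supported in `1/2 ≤ |s| ≤ 3/2` overlap. -/
theorem sum_abs_dyadic_le {g : ℝ → ℝ} {C : ℝ}
    (hg : ∀ s, ¬(1 / 2 ≤ |s| ∧ |s| ≤ 3 / 2) → g s = 0) (hC : ∀ s, |g s| ≤ C) (E : Finset ℤ)
    (w : ℝ) : ∑ j ∈ E, |g ((2 : ℝ) ^ (-j) * w)| ≤ 3 * C := by
  have hC0 : 0 ≤ C := (abs_nonneg _).trans (hC 0)
  by_cases hE : ∃ k ∈ E, g ((2 : ℝ) ^ (-k) * w) ≠ 0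
  · obtain ⟨k, -, hk⟩ := hE
    have key : ∀ j : ℤ, g ((2 : ℝ) ^ (-j) * w) ≠ 0 →
        (2 : ℝ) ^ (j - 1) ≤ |w| ∧ |w| < (2 : ℝ) ^ (j + 1) := by
      intro j hj
      have h1 := not_imp_comm.1 (hg _) hj
      have h2 : (0 : ℝ) < 2 ^ j := by positivity
      rw [abs_mul, abs_of_pos (by positivity), zpow_neg, inv_mul_eq_div, le_div_iff₀ h2,
        div_le_iff₀ h2] at h1
      rw [zpow_sub_one₀ two_ne_zero, zpow_add_one₀ two_ne_zero]
      constructor <;> linarith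
    have hsub : ∀ j ∈ E, j ∉ E ∩ Finset.Icc (k - 1) (k + 1) →
        |g ((2 : ℝ) ^ (-j) * w)| = 0 := by
      intro j hj hn
      by_contra hc
      have h1 := key j (fun h => hc (by rw [h, abs_zero]))
      have h2 := key k hk
      have h3 := (zpow_lt_zpow_iff_right₀ (one_lt_two (α := ℝ))).1 (h1.1.trans_lt h2.2)
      have h4 := (zpow_lt_zpow_iff_right₀ (one_lt_two (α := ℝ))).1 (h2.1.trans_lt h1.2)
      exact hn (Finset.mem_inter.2 ⟨hj, Finset.mem_Icc.2 ⟨by omega, by omega⟩⟩)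
    rw [← Finset.sum_subset Finset.inter_subset_left hsub]
    calc _ ≤ ∑ j ∈ Finset.Icc (k - 1) (k + 1), |g ((2 : ℝ) ^ (-j) * w)| :=
          Finset.sum_le_sum_of_subset_of_nonneg Finset.inter_subset_right
            fun _ _ _ => abs_nonneg _
      _ ≤ (Finset.Icc (k - 1) (k + 1)).card • C :=
          Finset.sum_le_card_nsmul _ _ _ fun j _ => hC _
      _ = 3 * C := by
          rw [Int.card_Icc, show (k + 1 + 1 - (k - 1)).toNat = 3 by omega]
          simp
  · push Not at hE
    rw [Finset.sum_eq_zero fun j hj => by rw [hE j hj, abs_zero]]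
    positivity

theorem bet_pos (s : ℝ) : 0 < bet s := Real.sqrt_pos.2 (by positivity)

theorem continuous_bet : Continuous bet := by unfold bet; fun_prop

theorem bet_neg (s : ℝ) : bet (-s) = bet s := by simp [bet]

theorem bet_two_mul_sinh (u : ℝ) : bet (2 * Real.sinh u) = Real.cosh u := by
  rw [bet, show 1 + (2 * Real.sinh u) ^ 2 / 4 = Real.cosh u ^ 2 by rw [Real.cosh_sq]; ring,
    Real.sqrt_sq (Real.cosh_pos u).le]

theorem integral_comp_two_mul_sinh (g : ℝ → ℝ) :
    ∫ σ, g σ = ∫ u, 2 * Real.cosh u * g (2 * Real.sinh u) := by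
  have h := integral_image_eq_integral_abs_deriv_smul (s := Set.univ)
    (f := fun u => 2 * Real.sinh u) (f' := fun u => 2 * Real.cosh u) MeasurableSet.univ
    (fun u _ => ((Real.hasDerivAt_sinh u).const_mul 2).hasDerivWithinAt)
    (fun x _ y _ hxy => Real.sinh_injective (by simpa using hxy)) g
  have hsurj : Function.Surjective fun u => 2 * Real.sinh u := fun y => by
    obtain ⟨x, hx⟩ := Real.sinh_surjective (y / 2)
    exact ⟨x, by simp only [hx]; ring⟩
  rw [Set.image_univ, hsurj.range_eq, setIntegral_univ, setIntegral_univ] at h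
  rw [h]
  congr 1
  ext u
  rw [abs_of_pos (by have := Real.cosh_pos u; positivity), smul_eq_mul]

theorem CutoffFun.chi1_eq_zero {η₀ : ℝ → ℝ} (h : CutoffFun η₀) (j : ℤ) {σ : ℝ}
    (hσ : σ ∉ Set.Icc (-(2 * (2 : ℝ) ^ j)) (2 * (2 : ℝ) ^ j)) : chi1 η₀ j σ = 0 := by
  rw [chi1, h.etad_eq_zero, mul_zero, zero_div]
  rintro ⟨-, h1⟩
  have h2 : (0 : ℝ) < 2 ^ j := by positivity
  rw [abs_mul, abs_of_pos (by positivity), zpow_neg, inv_mul_eq_div, div_le_iff₀ h2] at h1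
  exact hσ (abs_le.1 (by linarith))

theorem CutoffFun.continuous_chi1 {η₀ : ℝ → ℝ} (h : CutoffFun η₀) (j : ℤ) :
    Continuous (chi1 η₀ j) := by
  have h1 := h.contDiff_etad.continuous
  have h2 := continuous_bet
  unfold chi1
  exact Continuous.div (by fun_prop) h2 fun s => (bet_pos s).ne'

theorem CutoffFun.chi1_neg {η₀ : ℝ → ℝ} (h : CutoffFun η₀) (j : ℤ) (s : ℝ) :
    chi1 η₀ j (-s) = chi1 η₀ j s := by
  simp only [chi1, bet_neg, mul_neg, h.etad_neg]

theorem CutoffFun.integrable_mul_chi1 {η₀ : ℝ → ℝ} (h : CutoffFun η₀) (j : ℤ) {F : ℝ → ℂ}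
    (hF : Continuous F) : Integrable fun σ => F σ * (chi1 η₀ j σ : ℂ) := by
  have h1 := h.continuous_chi1 j
  refine Continuous.integrable_of_hasCompactSupport (by fun_prop)
    (HasCompactSupport.intro
      (isCompact_Icc (a := -(2 * (2 : ℝ) ^ j)) (b := 2 * (2 : ℝ) ^ j)) fun σ hσ => ?_)
  rw [h.chi1_eq_zero j hσ, Complex.ofReal_zero, mul_zero]

/-- By parity, `h_j` is a real oscillatory integral; the substitution `σ = 2 sinh u` turns its
phase into a combination of `exp u` and `exp (-u)`. -/
theorem CutoffFun.hfun_eq {η₀ : ℝ → ℝ} (h : CutoffFun η₀) (γ : ℝ) (j : ℤ) (ξ₁ x₂ y₂ : ℝ) :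
    hfun η₀ γ j ξ₁ x₂ y₂ = ((2 * ∫ u, Real.sin
      ((|x₂ ^ 2 - y₂ ^ 2| / 2 + (γ * (x₂ ^ 2 + y₂ ^ 2) - ξ₁)) * Real.exp u +
        (|x₂ ^ 2 - y₂ ^ 2| / 2 - (γ * (x₂ ^ 2 + y₂ ^ 2) - ξ₁)) * Real.exp (-u)) *
      etad η₀ ((2 : ℝ) ^ (-j) * (2 * Real.sinh u)) : ℝ) : ℂ) := by
  set b := |x₂ ^ 2 - y₂ ^ 2|
  set a := γ * (x₂ ^ 2 + y₂ ^ 2) - ξ₁ with ha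
  have hb := continuous_bet
  have hreal : (∫ σ : ℝ, Complex.exp (Complex.I * (σ * γ * (x₂ ^ 2 + y₂ ^ 2) - σ * ξ₁ : ℝ)) *
      ((Real.sin (bet σ * b) * chi1 η₀ j σ : ℝ) : ℂ)) =
      ((∫ σ : ℝ, Real.sin (bet σ * b + a * σ) * chi1 η₀ j σ : ℝ) : ℂ) := by
    rw [← integral_complex_ofReal, ← sub_eq_zero]
    have e1 : (fun σ : ℝ => Complex.exp (Complex.I * (σ * γ * (x₂ ^ 2 + y₂ ^ 2) - σ * ξ₁ : ℝ)) *
        ((Real.sin (bet σ * b) * chi1 η₀ j σ : ℝ) : ℂ)) = fun σ =>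
        (((Real.cos (a * σ) : ℝ) : ℂ) + ((Real.sin (a * σ) : ℝ) : ℂ) * Complex.I) *
          ((Real.sin (bet σ * b) : ℝ) : ℂ) * (chi1 η₀ j σ : ℂ) := by
      ext σ
      rw [show σ * γ * (x₂ ^ 2 + y₂ ^ 2) - σ * ξ₁ = a * σ by rw [ha]; ring, mul_comm Complex.I,
        Complex.exp_mul_I]
      push_cast
      ring
    have e2 : (fun σ : ℝ => ((Real.sin (bet σ * b + a * σ) * chi1 η₀ j σ : ℝ) : ℂ)) = fun σ =>
        ((Real.sin (bet σ * b + a * σ) : ℝ) : ℂ) * (chi1 η₀ j σ : ℂ) := by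
      ext σ; push_cast; ring
    rw [e1, e2, ← integral_sub (h.integrable_mul_chi1 j (by fun_prop))
      (h.integrable_mul_chi1 j (by fun_prop))]
    refine integral_eq_zero_of_odd fun s => ?_
    rw [h.chi1_neg, bet_neg, mul_neg, Real.cos_neg, Real.sin_neg, Real.sin_add, Real.sin_add,
      Real.cos_neg, Real.sin_neg]
    push_cast
    ring
  rw [hfun, hreal, integral_comp_two_mul_sinh, ← Complex.ofReal_mul]
  congr 1
  rw [← integral_const_mul, ← integral_const_mul]
  congr 1
  ext u
  have hc := Real.cosh_pos u
  rw [chi1, bet_two_mul_sinh,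
    show Real.cosh u * b + a * (2 * Real.sinh u) =
      (b / 2 + a) * Real.exp u + (b / 2 - a) * Real.exp (-u) by
        rw [Real.cosh_eq, Real.sinh_eq]; ring]
  have h2 : (2 : ℝ) ^ j ≠ 0 := by positivity
  have h3 : (2 : ℝ) ^ (-j) * 2 ^ j = 1 := by rw [zpow_neg, inv_mul_cancel₀ h2]
  generalize Real.sin _ = S
  generalize etad η₀ _ = e
  rw [show (2 : ℝ) ^ (-j) * (2 * Real.cosh u * (S * (2 ^ j * e / Real.cosh u))) =
    ((2 : ℝ) ^ (-j) * 2 ^ j) * (2 * (S * e)) by field_simp, h3, one_mul]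

theorem CutoffFun.norm_hfun_le {η₀ : ℝ → ℝ} (h : CutoffFun η₀) (γ : ℝ) (j : ℤ)
    (ξ₁ x₂ y₂ : ℝ) :
    ‖hfun η₀ γ j ξ₁ x₂ y₂‖ ≤ 4 * (2 : ℝ) ^ j * |x₂ ^ 2 - y₂ ^ 2| := by
  set b := |x₂ ^ 2 - y₂ ^ 2|
  have hb : 0 ≤ b := abs_nonneg _
  have h2 : (0 : ℝ) < 2 ^ j := by positivity
  rw [hfun, ← setIntegral_eq_integral_of_forall_compl_eq_zero
    (s := Set.Icc (-(2 * (2 : ℝ) ^ j)) (2 * (2 : ℝ) ^ j))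
    (fun σ hσ => by rw [h.chi1_eq_zero j hσ, mul_zero, Complex.ofReal_zero, mul_zero]), norm_mul]
  have h1 := norm_setIntegral_le_of_norm_le_const (μ := volume)
    (s := Set.Icc (-(2 * (2 : ℝ) ^ j)) (2 * (2 : ℝ) ^ j)) (C := 2 ^ j * b)
    (f := fun σ : ℝ => Complex.exp (Complex.I * (σ * γ * (x₂ ^ 2 + y₂ ^ 2) - σ * ξ₁ : ℝ)) *
      ((Real.sin (bet σ * b) * chi1 η₀ j σ : ℝ) : ℂ)) (by simp) (fun σ _ => ?_)
  · rw [Real.volume_real_Icc_of_le (by linarith)] at h1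
    calc _ ≤ ‖(((2 : ℝ) ^ (-j) : ℝ) : ℂ)‖ * (2 ^ j * b * (2 * 2 ^ j - -(2 * 2 ^ j))) := by
          gcongr
      _ = _ := by
          rw [Complex.norm_real, Real.norm_of_nonneg (by positivity), zpow_neg]
          field_simp
          ring
  · rw [norm_mul, mul_comm Complex.I, Complex.norm_exp_ofReal_mul_I, one_mul, Complex.norm_real,
      Real.norm_eq_abs, abs_mul, chi1, abs_div, abs_mul, abs_of_pos h2, abs_of_pos (bet_pos σ)]
    have h3 : |Real.sin (bet σ * b)| ≤ bet σ * b :=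
      Real.abs_sin_le_abs.trans_eq (abs_of_nonneg (mul_nonneg (bet_pos σ).le hb))
    have h4 := h.abs_etad_le ((2 : ℝ) ^ (-j) * σ)
    have h5 := bet_pos σ
    calc _ ≤ (bet σ * b) * (2 ^ j * 1 / bet σ) := by gcongr
      _ = _ := by field_simp

theorem CutoffFun.exists_norm_sum_hfun_le {η₀ : ℝ → ℝ} (h : CutoffFun η₀) :
    ∃ C, ∀ (γ : ℝ) (E : Finset ℤ), (∀ j ∈ E, 10 < j) → ∀ ξ₁ x₂ y₂ : ℝ,
      ‖∑ j ∈ E, hfun η₀ γ j ξ₁ x₂ y₂‖ ≤ C := by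
  obtain ⟨C₁, hC₁⟩ := h.exists_abs_deriv_etad_le
  refine ⟨60 * max 3 (12 * C₁), fun γ E hE ξ₁ x₂ y₂ => ?_⟩
  simp only [h.hfun_eq]
  set α := |x₂ ^ 2 - y₂ ^ 2| / 2 + (γ * (x₂ ^ 2 + y₂ ^ 2) - ξ₁)
  set δ := |x₂ ^ 2 - y₂ ^ 2| / 2 - (γ * (x₂ ^ 2 + y₂ ^ 2) - ξ₁)
  set R : ℝ := ∑ j ∈ E, (2 : ℝ) ^ j + 1 with hR
  have hR0 : 0 ≤ R := by positivity
  have hcont := h.contDiff_etad.continuous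
  have hloc : ∀ j ∈ E, ∫ u, Real.sin (α * Real.exp u + δ * Real.exp (-u)) *
      etad η₀ ((2 : ℝ) ^ (-j) * (2 * Real.sinh u)) =
      ∫ u in -R..R, Real.sin (α * Real.exp u + δ * Real.exp (-u)) *
        etad η₀ ((2 : ℝ) ^ (-j) * (2 * Real.sinh u)) := by
    intro j hj
    refine (intervalIntegral.integral_eq_integral_of_support_subset fun u hu => ?_).symm
    have h1 := not_imp_comm.1 (h.etad_eq_zero) (right_ne_zero_of_mul hu)
    have h2 : (0 : ℝ) < 2 ^ j := by positivity
    have h3 := h1.2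
    rw [abs_mul, abs_of_pos (by positivity), zpow_neg, inv_mul_eq_div, div_le_iff₀ h2, abs_mul,
      abs_two, Real.abs_sinh] at h3
    have h4 : |u| ≤ Real.sinh |u| := Real.self_le_sinh_iff.2 (abs_nonneg u)
    have h5 : (2 : ℝ) ^ j ≤ ∑ j ∈ E, (2 : ℝ) ^ j :=
      Finset.single_le_sum (f := fun j => (2 : ℝ) ^ j) (fun i _ => by positivity) hj
    have h6 := abs_lt.1 (show |u| < R by linarith)
    exact ⟨h6.1, h6.2.le⟩
  set m : ℝ → ℝ := fun u => ∑ j ∈ E, etad η₀ ((2 : ℝ) ^ (-j) * (2 * Real.sinh u)) with hm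
  have hms : ContDiff ℝ 1 m := ContDiff.sum fun j _ =>
    (h.contDiff_etad.of_le (by exact_mod_cast le_top)).comp
      (contDiff_const.mul (contDiff_const.mul Real.contDiff_sinh))
  have hmd : ∀ u, HasDerivAt m (∑ j ∈ E, deriv (etad η₀) ((2 : ℝ) ^ (-j) * (2 * Real.sinh u)) *
      ((2 : ℝ) ^ (-j) * (2 * Real.cosh u))) u := fun u =>
    HasDerivAt.fun_sum fun j _ =>
      ((h.contDiff_etad.differentiable (by simp) _).hasDerivAt).comp u
        (((Real.hasDerivAt_sinh u).const_mul 2).const_mul _)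
  have hM : ∀ u, |m u| ≤ max 3 (12 * C₁) := fun u =>
    (Finset.abs_sum_le_sum_abs _ _).trans
      ((sum_abs_dyadic_le (fun _ => h.etad_eq_zero) h.abs_etad_le E _).trans
        (by rw [mul_one]; exact le_max_left _ _))
  have hM' : ∀ u, |deriv m u| ≤ max 3 (12 * C₁) := fun u => by
    rw [(hmd u).deriv]
    have h1 := sum_abs_dyadic_le (fun _ => h.deriv_etad_eq_zero) hC₁ E (2 * Real.sinh u)
    calc _ ≤ ∑ j ∈ E, 4 * |deriv (etad η₀) ((2 : ℝ) ^ (-j) * (2 * Real.sinh u))| := by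
          refine (Finset.abs_sum_le_sum_abs _ _).trans (Finset.sum_le_sum fun j hj => ?_)
          by_cases hs : 1 / 2 ≤ |(2 : ℝ) ^ (-j) * (2 * Real.sinh u)| ∧
              |(2 : ℝ) ^ (-j) * (2 * Real.sinh u)| ≤ 3 / 2
          · rw [abs_mul, mul_comm]
            gcongr
            have h2 := hs.2
            have h3 : (0 : ℝ) < 2 ^ (-j) := by positivity
            have h4 : (2 : ℝ) ^ (-j) ≤ 1 :=
              zpow_le_one_of_nonpos₀ one_le_two (by linarith [hE j hj])
            have h5 : Real.cosh u ≤ |Real.sinh u| + 1 := by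
              have := Real.cosh_sq u
              have := Real.cosh_pos u
              have := sq_abs (Real.sinh u)
              have := abs_nonneg (Real.sinh u)
              nlinarith
            have hc := Real.cosh_pos u
            rw [abs_mul, abs_mul, abs_of_pos h3, abs_two] at h2
            rw [abs_of_pos (by positivity)]
            nlinarith
          · rw [h.deriv_etad_eq_zero hs]; simp
      _ ≤ 12 * C₁ := by rw [← Finset.mul_sum]; linarith
      _ ≤ _ := le_max_right _ _
  have hmain := abs_integral_sin_mul_le (α := α) (δ := δ) hms hM hM' hR0
  rw [← Complex.ofReal_sum, Complex.norm_real, ← Finset.mul_sum, Finset.sum_congr rfl hloc,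
    ← intervalIntegral.integral_finsetSum
      (fun j _ => Continuous.intervalIntegrable (by fun_prop) _ _)]
  simp only [← Finset.mul_sum]
  rw [norm_mul, Real.norm_eq_abs, Real.norm_eq_abs, abs_two]
  linarith

theorem CutoffFun.chi2t_eq_zero {η₀ : ℝ → ℝ} (h : CutoffFun η₀) {j : ℤ} {s : ℝ}
    (hs : ¬((2 : ℝ) ^ j ≤ 2 * |s| ∧ |s| ≤ 3 / 2 * (2 : ℝ) ^ j)) : chi2t η₀ j s = 0 := by
  rw [chi2t, h.etad_eq_zero, mul_zero, zero_div]
  intro h1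
  have h2 : (0 : ℝ) < 2 ^ j := by positivity
  rw [abs_mul, abs_of_pos (by positivity), zpow_neg, inv_mul_eq_div, div_le_iff₀ h2,
    le_div_iff₀ h2] at h1
  exact hs ⟨by linarith, h1.2⟩

theorem CutoffFun.abs_chi2t_le {η₀ : ℝ → ℝ} (h : CutoffFun η₀) (j : ℤ) (s : ℝ) :
    |chi2t η₀ j s| ≤ 2 := by
  by_cases hs : (2 : ℝ) ^ j ≤ 2 * |s| ∧ |s| ≤ 3 / 2 * (2 : ℝ) ^ j
  · have h2 : (0 : ℝ) < 2 ^ j := by positivity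
    have h3 := h.abs_etad_le ((2 : ℝ) ^ (-j) * s)
    rw [chi2t, abs_div, abs_mul, abs_abs, abs_of_pos h2, div_le_iff₀ (by linarith)]
    nlinarith [hs.1]
  · rw [h.chi2t_eq_zero hs]; simp

/-- The restriction of `η` to the positive half-line. -/
def etaPos (η₀ : ℝ → ℝ) (s : ℝ) : ℝ := etad η₀ s * Real.smoothTransition (2 * s)

theorem CutoffFun.contDiff_etaPos {η₀ : ℝ → ℝ} (h : CutoffFun η₀) :
    ContDiff ℝ (⊤ : ℕ∞) (etaPos η₀) :=
  h.contDiff_etad.mul (Real.smoothTransition.contDiff.comp (contDiff_const.mul contDiff_id))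

theorem CutoffFun.etaPos_eq_zero {η₀ : ℝ → ℝ} (h : CutoffFun η₀) {s : ℝ}
    (hs : ¬(1 / 2 ≤ s ∧ s ≤ 3 / 2)) : etaPos η₀ s = 0 := by
  rcases le_total s 0 with h0 | h0
  · rw [etaPos, Real.smoothTransition.zero_of_nonpos (by linarith), mul_zero]
  · rw [etaPos, h.etad_eq_zero (by rwa [abs_of_nonneg h0]), zero_mul]

theorem CutoffFun.etaPos_add_etaPos_neg {η₀ : ℝ → ℝ} (h : CutoffFun η₀) (s : ℝ) :
    etaPos η₀ s + etaPos η₀ (-s) = etad η₀ s := by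
  by_cases hs : 1 / 2 ≤ |s| ∧ |s| ≤ 3 / 2
  · rcases le_total 0 s with h0 | h0
    · rw [abs_of_nonneg h0] at hs
      rw [etaPos, etaPos, Real.smoothTransition.one_of_one_le (by linarith),
        Real.smoothTransition.zero_of_nonpos (by linarith)]
      ring
    · rw [abs_of_nonpos h0] at hs
      rw [etaPos, etaPos, Real.smoothTransition.one_of_one_le (x := 2 * -s) (by linarith),
        Real.smoothTransition.zero_of_nonpos (by linarith), h.etad_neg]
      ring
  · rw [etaPos, etaPos, h.etad_neg, h.etad_eq_zero hs]
    ring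

theorem CutoffFun.exists_abs_integral_etaPos_le {η₀ : ℝ → ℝ} (h : CutoffFun η₀) (N : ℕ) :
    ∃ C, ∀ a b : ℝ, 0 ≤ b → a ≠ 0 → 2 * b ≤ |a| → ∀ j : ℤ, 10 < j →
      ((2 : ℝ) ^ j * |a|) ^ N * |∫ u, Real.sin ((b / 2 + a) * Real.exp u +
        (b / 2 - a) * Real.exp (-u)) * etaPos η₀ ((2 : ℝ) ^ (-j) * (2 * Real.sinh u))| ≤ C := by
  set K : Set (ℝ × ℝ × ℝ) := Set.Icc (-1) 1 ×ˢ Set.Icc 0 2 ×ˢ Set.Icc 0 1 with hK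
  have hKc : IsCompact K := isCompact_Icc.prod (isCompact_Icc.prod isCompact_Icc)
  set q : (ℝ × ℝ × ℝ) × ℝ → ℝ := fun w =>
    Real.exp (w.1.1 + w.2) - w.1.2.1 ^ 2 * Real.exp (-w.2) with hq
  set q' : (ℝ × ℝ × ℝ) × ℝ → ℝ := fun w =>
    Real.exp (w.1.1 + w.2) + w.1.2.1 ^ 2 * Real.exp (-w.2) with hq'
  set f : (ℝ × ℝ × ℝ) × ℝ → ℝ := fun w =>
    etaPos η₀ (Real.exp w.2 - w.1.2.2 ^ 2 * Real.exp (-w.2)) with hf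
  have hpos : ∀ w, 0 < q' w := fun w => by simp only [hq']; positivity
  have hq's : ContDiff ℝ (⊤ : ℕ∞) q' := by fun_prop
  have hfs : ContDiff ℝ (⊤ : ℕ∞) f := h.contDiff_etaPos.comp (by fun_prop)
  have hsupp : ∀ p ∈ K, ∀ s ∉ Set.Icc (-2 : ℝ) 2, f (p, s) = 0 := by
    intro p hp s hs
    refine h.etaPos_eq_zero fun h1 => hs ?_
    have hp3 := hp.2.2
    dsimp only at h1
    have e0 := Real.exp_pos s
    have e1 : Real.exp (-s) * Real.exp s = 1 := by rw [← Real.exp_add]; simp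
    have e3 := Real.exp_pos (-s)
    have hz : p.2.2 ^ 2 ≤ 1 := by nlinarith [hp3.1, hp3.2]
    have hz0 := sq_nonneg p.2.2
    have e2 : (2 : ℝ) ≤ Real.exp 1 := by linarith [Real.add_one_le_exp (1 : ℝ)]
    have e4 : (4 : ℝ) ≤ Real.exp 2 := by
      rw [show (2 : ℝ) = 1 + 1 by norm_num, Real.exp_add]; nlinarith
    have hlow : 1 / 2 ≤ Real.exp s := by nlinarith
    have hup : Real.exp s ≤ 7 / 2 := by
      have : Real.exp (-s) ≤ 2 := by nlinarith
      nlinarith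
    constructor
    · by_contra hc
      have h5 : Real.exp 2 ≤ Real.exp (-s) := Real.exp_le_exp.2 (by linarith)
      nlinarith
    · exact Real.exp_le_exp.1 (by linarith)
  obtain ⟨C, hC⟩ := exists_bound_nonstationary hKc (q := q) (q' := q') (G := fun w => (q' w)⁻¹)
    (by fun_prop) hq's.continuous
    (fun p _ s => by
      have h1 := (((hasDerivAt_id s).const_add p.1).exp).sub
        (((hasDerivAt_neg s).exp).const_mul (p.2.1 ^ 2))
      refine h1.congr_deriv ?_
      simp only [hq', id]; ring)
    (hq's.inv fun w => (hpos w).ne') (fun p _ s => mul_inv_cancel₀ (hpos _).ne')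
    (r := 2) (by norm_num) N f hfs hsupp
  refine ⟨C, fun a b hb ha hab j hj => ?_⟩
  set l : ℝ := (2 : ℝ) ^ j with hl
  have hl0 : 0 < l := by positivity
  have hl1 : 1 ≤ l := one_le_zpow₀ one_le_two (by linarith)
  set τ : ℝ := b / (2 * a) with hτ
  have haτ : a * τ = b / 2 := by rw [hτ]; field_simp
  have hτ1 : |τ| ≤ 1 / 4 := by
    rw [hτ, abs_div, abs_mul, abs_two, abs_of_nonneg hb, div_le_iff₀ (by positivity)]
    linarith
  have hτ2 := abs_le.1 hτ1
  have hx : Real.log (1 + τ) ∈ Set.Icc (-1 : ℝ) 1 := by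
    have h1 := Real.log_le_sub_one_of_pos (x := 1 + τ) (by linarith)
    have h2 := Real.one_sub_inv_le_log_of_pos (x := 1 + τ) (by linarith)
    have h3 : (1 + τ)⁻¹ ≤ 2 := by
      rw [inv_le_comm₀ (by linarith) (by norm_num)]; linarith
    constructor <;> linarith
  have hz : l⁻¹ ∈ Set.Icc (0 : ℝ) 1 := ⟨by positivity, inv_le_one_of_one_le₀ hl1⟩
  have hy : l⁻¹ * Real.sqrt (1 - τ) ∈ Set.Icc (0 : ℝ) 2 := by
    refine ⟨by positivity, ?_⟩
    have : Real.sqrt (1 - τ) ≤ 2 := Real.sqrt_le_iff.2 ⟨by norm_num, by linarith⟩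
    nlinarith [hz.1, hz.2, Real.sqrt_nonneg (1 - τ)]
  have hp : (Real.log (1 + τ), l⁻¹ * Real.sqrt (1 - τ), l⁻¹) ∈ K := ⟨hx, hy, hz⟩
  have hmain := hC _ hp (l * a) 0
  rw [abs_mul, abs_of_pos hl0] at hmain
  refine le_of_eq_of_le ?_ hmain
  congr 2
  rw [← integral_add_right_eq_self _ (Real.log l),
    intervalIntegral.integral_eq_integral_of_support_subset]
  · congr 1
    ext v
    have e1 : Real.exp (v + Real.log l) = l * Real.exp v := by
      rw [Real.exp_add, Real.exp_log hl0, mul_comm]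
    have e2 : Real.exp (-(v + Real.log l)) = l⁻¹ * Real.exp (-v) := by
      rw [neg_add, Real.exp_add, Real.exp_neg (Real.log l), Real.exp_log hl0, mul_comm]
    congr 1
    · congr 1
      simp only [hq]
      rw [e1, e2, Real.exp_add, Real.exp_log (by linarith), mul_pow, Real.sq_sqrt (by linarith),
        ← haτ]
      field_simp
      ring
    · simp only [hf]
      congr 1
      rw [Real.sinh_eq, e1, e2, zpow_neg, ← hl]
      field_simp
  · intro v hv
    have h1 := not_imp_comm.1 (hsupp _ hp v) (right_ne_zero_of_mul hv)
    constructor <;> linarith [h1.1, h1.2]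

theorem CutoffFun.exists_norm_hfun_le_pow {η₀ : ℝ → ℝ} (h : CutoffFun η₀) (N : ℕ) :
    ∃ C > 0, ∀ γ : ℝ, ∀ j : ℤ, 10 < j → ∀ ξ₁ x₂ y₂ : ℝ,
      2 * |x₂ ^ 2 - y₂ ^ 2| ≤ |ξ₁ - γ * (x₂ ^ 2 + y₂ ^ 2)| →
        ‖hfun η₀ γ j ξ₁ x₂ y₂‖ ≤
          C * (((2 : ℝ) ^ j * |ξ₁ - γ * (x₂ ^ 2 + y₂ ^ 2)|) ^ N)⁻¹ := by
  obtain ⟨C, hC⟩ := h.exists_abs_integral_etaPos_le N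
  refine ⟨4 * |C| + 1, by positivity, fun γ j hj ξ₁ x₂ y₂ hab => ?_⟩
  rw [abs_sub_comm ξ₁] at hab ⊢
  rcases eq_or_ne (γ * (x₂ ^ 2 + y₂ ^ 2) - ξ₁) 0 with ha | ha
  · have h1 := h.norm_hfun_le γ j ξ₁ x₂ y₂
    rw [ha, abs_zero] at hab
    have h2 : |x₂ ^ 2 - y₂ ^ 2| = 0 := le_antisymm (by linarith) (abs_nonneg _)
    rw [h2, mul_zero] at h1
    exact h1.trans (by positivity)
  rw [h.hfun_eq, Complex.norm_real]
  set b := |x₂ ^ 2 - y₂ ^ 2|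
  set a := γ * (x₂ ^ 2 + y₂ ^ 2) - ξ₁
  have hb : 0 ≤ b := abs_nonneg _
  have hcont := h.contDiff_etaPos.continuous
  set J : ℝ → ℝ → ℝ := fun a u => Real.sin ((b / 2 + a) * Real.exp u +
    (b / 2 - a) * Real.exp (-u)) * etaPos η₀ ((2 : ℝ) ^ (-j) * (2 * Real.sinh u)) with hJ
  have hJint : ∀ a, Integrable (J a) := fun a => by
    refine Continuous.integrable_of_hasCompactSupport (by fun_prop)
      (HasCompactSupport.intro (isCompact_Icc (a := -(2 : ℝ) ^ j) (b := (2 : ℝ) ^ j))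
        fun u hu => ?_)
    simp only [hJ]
    rw [h.etaPos_eq_zero, mul_zero]
    intro h1
    have h2 : (0 : ℝ) < 2 ^ j := by positivity
    rw [zpow_neg, inv_mul_eq_div, div_le_iff₀ h2, le_div_iff₀ h2] at h1
    have h0 : 0 ≤ u := Real.sinh_nonneg_iff.1 (by linarith)
    have h3 := Real.self_le_sinh_iff.2 h0
    exact hu ⟨by linarith, by linarith⟩
  have hsplit : (∫ u, Real.sin ((b / 2 + a) * Real.exp u + (b / 2 - a) * Real.exp (-u)) *
      etad η₀ ((2 : ℝ) ^ (-j) * (2 * Real.sinh u))) = (∫ u, J a u) + ∫ u, J (-a) u := by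
    rw [← integral_neg_eq_self (J (-a)), ← integral_add (hJint a) (hJint (-a)).comp_neg]
    congr 1
    ext u
    simp only [hJ]
    rw [← h.etaPos_add_etaPos_neg, Real.sinh_neg, neg_neg, sub_neg_eq_add, ← sub_eq_add_neg,
      add_comm ((b / 2 - a) * _)]
    ring_nf
  have h1 := hC a b hb ha hab j hj
  have h2 := hC (-a) b hb (neg_ne_zero.2 ha) (by rwa [abs_neg]) j hj
  rw [abs_neg] at h2
  rw [hsplit, ← div_eq_mul_inv, le_div_iff₀ (by positivity), norm_mul, Real.norm_eq_abs,
    Real.norm_eq_abs, abs_two]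
  have h3 := abs_add_le (∫ u, J a u) (∫ u, J (-a) u)
  have h4 := le_abs_self C
  have h5 : 0 < ((2 : ℝ) ^ j * |a|) ^ N := by positivity
  change _ * |∫ u, J a u| ≤ _ at h1
  change _ * |∫ u, J (-a) u| ≤ _ at h2
  nlinarith

theorem stmt8 (Γ : ℝ) (hΓ : 1 / 2 < Γ) (η₀ : ℝ → ℝ) (hη₀ : CutoffFun η₀) :
    (∃ C > 0, ∀ γ : ℝ, 1 / 2 ≤ |γ| → |γ| ≤ Γ →
      -- (i)
      (∀ E : Finset ℤ, (∀ j₁ ∈ E, 10 < j₁) → ∀ j₂ : ℤ, ∀ ξ₁ x₂ y₂ : ℝ,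
        ‖(chi2t η₀ j₂ (x₂ - y₂) : ℂ) * ∑ j₁ ∈ E, hfun η₀ γ j₁ ξ₁ x₂ y₂‖ ≤ C ∧
        (¬((2 : ℝ) ^ (j₂ - 2) ≤ |x₂ - y₂| ∧ |x₂ - y₂| ≤ (2 : ℝ) ^ (j₂ + 2)) →
          (chi2t η₀ j₂ (x₂ - y₂) : ℂ) * ∑ j₁ ∈ E, hfun η₀ γ j₁ ξ₁ x₂ y₂ = 0)) ∧
      -- (ii)
      (∀ j₁ : ℤ, 10 < j₁ → ∀ ξ₁ x₂ y₂ : ℝ,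
        ‖hfun η₀ γ j₁ ξ₁ x₂ y₂‖ ≤ C * (2 : ℝ) ^ j₁ * |x₂ ^ 2 - y₂ ^ 2|)) ∧
    -- (iii)
    (∀ N : ℕ, 0 < N → ∃ C_N > 0, ∀ γ : ℝ, 1 / 2 ≤ |γ| → |γ| ≤ Γ →
      ∀ j₁ : ℤ, 10 < j₁ → ∀ ξ₁ x₂ y₂ : ℝ,
        2 * |x₂ ^ 2 - y₂ ^ 2| ≤ |ξ₁ - γ * (x₂ ^ 2 + y₂ ^ 2)| →
          ‖hfun η₀ γ j₁ ξ₁ x₂ y₂‖ ≤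
            C_N * (((2 : ℝ) ^ j₁ * |ξ₁ - γ * (x₂ ^ 2 + y₂ ^ 2)|) ^ N)⁻¹) := by
  refine ⟨?_, fun N _ => ?_⟩
  · obtain ⟨C, hC⟩ := hη₀.exists_norm_sum_hfun_le
    have hC0 : 0 ≤ C := (norm_nonneg _).trans (hC 0 ∅ (by simp) 0 0 0)
    refine ⟨2 * C + 4, by positivity, fun γ _ _ => ⟨fun E hE j₂ ξ₁ x₂ y₂ => ⟨?_, fun hn => ?_⟩,
      fun j₁ _ ξ₁ x₂ y₂ => ?_⟩⟩
    · rw [norm_mul, Complex.norm_real, Real.norm_eq_abs]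
      calc _ ≤ 2 * C := mul_le_mul (hη₀.abs_chi2t_le _ _) (hC γ E hE ξ₁ x₂ y₂) (norm_nonneg _)
            zero_le_two
        _ ≤ _ := by linarith
    · rw [hη₀.chi2t_eq_zero, Complex.ofReal_zero, zero_mul]
      rintro ⟨h1, h2⟩
      have h3 : (0 : ℝ) < 2 ^ j₂ := by positivity
      refine hn ⟨?_, ?_⟩
      · rw [zpow_sub₀ two_ne_zero]
        norm_num
        linarith
      · rw [zpow_add₀ two_ne_zero]
        norm_num
        linarith
    · refine (hη₀.norm_hfun_le γ j₁ ξ₁ x₂ y₂).trans ?_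
      gcongr
      linarith
  · obtain ⟨C, hC0, hC⟩ := hη₀.exists_norm_hfun_le_pow N
    exact ⟨C, hC0, fun γ _ _ => hC γ⟩

end
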